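/- Let p = 2 and δ, δ' ∈ [0,2) with d − d_H + 2·min(δ,δ') − 4 > 0, and set C_2 = (d − d_H)(d − d_H + 2·min(δ,δ') − 4)/4. Then the Rellich inequality ∫_Ω |Hφ|² ≥ C_2² ∫_Ω (c_Ω d_Γ^{−2})² |φ|² holds for all φ ∈ C_c^2(Ω). -/

import Mathlib

open MeasureTheory Set
open scoped RealInnerProductSpace

noncomputable section

/-- The weight `c_Ω = c ∘ d_Γ` with `c(s) = s^δ (1+s)^(δ'-δ)`. -/
def cWeight {d : ℕ} (K : Set (EuclideanSpace ℝ (Fin d))) (δ δ' : ℝ)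
    (x : EuclideanSpace ℝ (Fin d)) : ℝ :=
  Metric.infDist x K ^ δ * (1 + Metric.infDist x K) ^ (δ' - δ)

/-- The Laplacian `Δφ = Σ_k ∂_k² φ`. -/
def lapl {d : ℕ} (φ : EuclideanSpace ℝ (Fin d) → ℝ) (x : EuclideanSpace ℝ (Fin d)) : ℝ :=
  ∑ i, iteratedFDeriv ℝ 2 φ x (fun _ => EuclideanSpace.single i (1 : ℝ))

/-- The weighted operator `H = -div(c_Ω ∇)`. -/
def Hop {d : ℕ} (K : Set (EuclideanSpace ℝ (Fin d))) (δ δ' : ℝ)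
    (φ : EuclideanSpace ℝ (Fin d) → ℝ) (x : EuclideanSpace ℝ (Fin d)) : ℝ :=
  -(cWeight K δ δ' x) * lapl φ x - ⟪gradient (cWeight K δ δ') x, gradient φ x⟫

section Geometry
set_option linter.unusedSectionVars false
variable {E : Type*} [NormedAddCommGroup E] [InnerProductSpace ℝ E] [FiniteDimensional ℝ E]

/-- `P` is the metric projection on `K`. -/
structure IsMP (K : Set E) (P : E → E) : Prop where
  mem : ∀ x, P x ∈ K
  inner_le : ∀ x, ∀ z ∈ K, ⟪x - P x, z - P x⟫ ≤ 0
  dist_eq : ∀ x, Metric.infDist x K = ‖x - P x‖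

theorem exists_isMP {K : Set E} (hKne : K.Nonempty) (hKcl : IsClosed K) (hKconv : Convex ℝ K) :
    ∃ P, IsMP K P := by
  have h := exists_norm_eq_iInf_of_complete_convex hKne hKcl.isComplete hKconv
  choose P hP hP2 using h
  refine ⟨P, hP, fun x => (norm_eq_iInf_iff_real_inner_le_zero hKconv (hP x)).1 (hP2 x), ?_⟩
  intro x
  rw [hP2 x, Metric.infDist_eq_iInf]
  simp [dist_eq_norm]

theorem IsMP.unique {K : Set E} {P : E → E} (h : IsMP K P) {x p : E} (hp : p ∈ K)
    (hx : ∀ z ∈ K, ⟪x - p, z - p⟫ ≤ 0) : P x = p := by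
  have h1 := hx _ (h.mem x)
  have h2 := h.inner_le x p hp
  have h3 : ⟪P x - p, P x - p⟫ ≤ 0 := by
    have e : ⟪P x - p, P x - p⟫ = ⟪x - p, P x - p⟫ + ⟪x - P x, p - P x⟫ := by
      simp only [inner_sub_left, inner_sub_right]; ring
    linarith
  rw [real_inner_self_eq_norm_sq] at h3
  have : ‖P x - p‖ = 0 := by nlinarith [norm_nonneg (P x - p)]
  exact sub_eq_zero.1 (norm_eq_zero.1 this)

theorem IsMP.firm {K : Set E} {P : E → E} (h : IsMP K P) (x y : E) :
    ‖(x - P x) - (y - P y)‖ ^ 2 ≤ ⟪(x - P x) - (y - P y), x - y⟫ := by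
  have h1 := h.inner_le x _ (h.mem y)
  have h2 := h.inner_le y _ (h.mem x)
  rw [← real_inner_self_eq_norm_sq]
  have e : ⟪(x - P x) - (y - P y), x - y⟫ = ⟪(x - P x) - (y - P y), (x - P x) - (y - P y)⟫
     - ⟪x - P x, P y - P x⟫ - ⟪y - P y, P x - P y⟫ := by
    simp only [inner_sub_left, inner_sub_right]; ring
  linarith

theorem IsMP.lip {K : Set E} {P : E → E} (h : IsMP K P) :
    LipschitzWith 1 (fun x => x - P x) := by
  refine LipschitzWith.of_dist_le_mul fun x y => ?_
  simp only [dist_eq_norm, NNReal.coe_one, one_mul]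
  have h1 := h.firm x y
  have h2 := real_inner_le_norm ((x - P x) - (y - P y)) (x - y)
  by_contra! hlt
  nlinarith [norm_nonneg (x - y)]

theorem IsMP.hasFDerivAt_sq {K : Set E} {P : E → E} (h : IsMP K P) (x : E) :
    HasFDerivAt (fun y => Metric.infDist y K ^ 2) ((2 : ℝ) • innerSL ℝ (x - P x)) x := by
  rw [hasFDerivAt_iff_isLittleO_nhds_zero]
  have key : ∀ v : E, ‖Metric.infDist (x + v) K ^ 2 - Metric.infDist x K ^ 2
      - ((2 : ℝ) • innerSL ℝ (x - P x)) v‖ ≤ 1 * ‖‖v‖ ^ 2‖ := by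
    intro v
    have a1 : Metric.infDist (x + v) K ≤ ‖x + v - P x‖ := by
      rw [← dist_eq_norm]; exact Metric.infDist_le_dist_of_mem (h.mem x)
    have a2 : Metric.infDist x K ≤ ‖x - P (x + v)‖ := by
      rw [← dist_eq_norm]; exact Metric.infDist_le_dist_of_mem (h.mem _)
    have b1 := pow_le_pow_left₀ Metric.infDist_nonneg a1 2
    have b2 := pow_le_pow_left₀ Metric.infDist_nonneg a2 2
    have c1 : ‖x + v - P x‖ ^ 2 = Metric.infDist x K ^ 2 + 2 * ⟪x - P x, v⟫ + ‖v‖ ^ 2 := by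
      rw [h.dist_eq x, ← norm_add_sq_real]; congr 2; abel
    have c2 : ‖x - P (x + v)‖ ^ 2 = Metric.infDist (x + v) K ^ 2
        - 2 * ⟪x + v - P (x + v), v⟫ + ‖v‖ ^ 2 := by
      rw [h.dist_eq (x + v), ← norm_sub_sq_real]; congr 2; abel
    have m := (sq_nonneg _).trans (h.firm (x + v) x)
    have m2 : ⟪x - P x, v⟫ ≤ ⟪x + v - P (x + v), v⟫ := by
      rw [inner_sub_left] at m
      simpa using m
    simp only [smul_apply, innerSL_apply_apply, smul_eq_mul, Real.norm_eq_abs,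
      one_mul, abs_pow, abs_norm]
    rw [abs_le]
    constructor <;> linarith
  refine (Asymptotics.IsBigO.of_bound 1 (Filter.Eventually.of_forall key)).trans_isLittleO ?_
  have := (Asymptotics.isLittleO_norm_pow_id (E' := E) (n := 2) one_lt_two)
  exact this

theorem IsMP.contDiff_sq {K : Set E} {P : E → E} (h : IsMP K P) :
    ContDiff ℝ 1 (fun y => Metric.infDist y K ^ 2) := by
  rw [contDiff_one_iff_fderiv]
  refine ⟨fun x => (h.hasFDerivAt_sq x).differentiableAt, ?_⟩
  have : fderiv ℝ (fun y => Metric.infDist y K ^ 2) = fun x => (2 : ℝ) • innerSL ℝ (x - P x) := by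
    ext1 x; exact (h.hasFDerivAt_sq x).fderiv
  rw [this]
  have := h.lip.continuous
  fun_prop

theorem trace_ge {A : E →L[ℝ] E} (hA : ∀ v, 0 ≤ ⟪v, A v⟫) (W : Submodule ℝ E)
    (hW : ∀ v ∈ W, A v = v) : (Module.finrank ℝ W : ℝ) ≤ LinearMap.trace ℝ E (A : E →ₗ[ℝ] E) := by
  let p : E →ₗ[ℝ] E := (W.starProjection : E →L[ℝ] E)
  let r : E →ₗ[ℝ] E := (Wᗮ.starProjection : E →L[ℝ] E)
  have hp : LinearMap.IsProj W p := ⟨fun x => W.starProjection_apply_mem x,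
    fun x hx => Submodule.starProjection_eq_self_iff.2 hx⟩
  have hrr : r ∘ₗ r = r := by
    ext1 x
    exact Submodule.starProjection_eq_self_iff.2 (Wᗮ.starProjection_apply_mem x)
  have e : (A : E →ₗ[ℝ] E) = p + (A : E →ₗ[ℝ] E) ∘ₗ r := by
    ext1 x
    have h1 : x = p x + r x := by
      have := W.starProjection_add_starProjection_orthogonal x
      exact this.symm
    have h2 : A (p x) = p x := hW _ (W.starProjection_apply_mem x)
    calc A x = A (p x + r x) := by rw [← h1]
      _ = p x + A (r x) := by rw [map_add, h2]
  rw [e, map_add, hp.trace]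
  have e2 : LinearMap.trace ℝ E ((A : E →ₗ[ℝ] E) ∘ₗ r)
      = LinearMap.trace ℝ E (r ∘ₗ ((A : E →ₗ[ℝ] E) ∘ₗ r)) := by
    conv_lhs => rw [← hrr, ← LinearMap.comp_assoc]
    rw [← Module.End.mul_eq_comp, LinearMap.trace_mul_comm]; rfl
  have : 0 ≤ LinearMap.trace ℝ E ((A : E →ₗ[ℝ] E) ∘ₗ r) := by
    rw [e2, LinearMap.trace_eq_sum_inner _ (stdOrthonormalBasis ℝ E)]
    refine Finset.sum_nonneg fun i _ => ?_
    have h3 : ∀ a b : E, ⟪a, r b⟫ = ⟪r a, b⟫ := fun a b => (Wᗮ.inner_starProjection_left_eq_right a b).symm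
    simp only [LinearMap.comp_apply, h3]
    exact hA _
  linarith

theorem IsMP.trace_fderiv_ge {K : Set E} {P : E → E} (h : IsMP K P) {x : E}
    (hx : Metric.infDist x K ≠ 0) {A : E →L[ℝ] E} (hA : HasFDerivAt (fun y => y - P y) A x)
    {n : ℕ} (hn : (n = 1 ∨ n + Module.finrank ℝ (affineSpan ℝ K).direction = Module.finrank ℝ E)) :
    (n : ℝ) ≤ LinearMap.trace ℝ E (A : E →ₗ[ℝ] E) := by
  have hl : ∀ v, HasDerivAt (fun t : ℝ => (x + t • v) - P (x + t • v)) (A v) 0 :=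
    fun v => (hA.hasLineDerivAt v)
  have hmono : ∀ v, 0 ≤ ⟪v, A v⟫ := by
    intro v
    have h1 : HasDerivAt (fun t : ℝ => ⟪v, (x + t • v) - P (x + t • v)⟫) ⟪v, A v⟫ 0 := by
      simpa using (hasDerivAt_const (0:ℝ) v).inner ℝ (hl v)
    have h2 : Monotone (fun t : ℝ => ⟪v, (x + t • v) - P (x + t • v)⟫) := by
      intro s t hst
      rcases hst.eq_or_lt with rfl | hst
      · exact le_rfl
      have m := (sq_nonneg _).trans (h.firm (x + t • v) (x + s • v))
      have e : x + t • v - (x + s • v) = (t - s) • v := by rw [sub_smul]; abel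
      rw [e, inner_smul_right, inner_sub_left] at m
      have := nonneg_of_mul_nonneg_right m (sub_pos.2 hst)
      simp only [real_inner_comm] at this ⊢
      rw [real_inner_comm, real_inner_comm v] 
      linarith
    rw [← h1.deriv]; exact h2.deriv_nonneg
  have hfix : ∀ v, (∀ᶠ t : ℝ in nhds 0, P (x + t • v) = P x) → A v = v := by
    intro v hv
    have h1 : HasDerivAt (fun t : ℝ => (x + t • v) - P x) v 0 := by
      simpa using (((hasDerivAt_id (0:ℝ)).smul_const v).const_add x).sub_const (P x)
    refine (hl v).unique (h1.congr_of_eventuallyEq ?_)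
    filter_upwards [hv] with t ht
    rw [ht]
  rcases hn with rfl | hn
  · have hy : x - P x ≠ 0 := by
      rw [h.dist_eq] at hx; exact norm_ne_zero_iff.1 hx
    have := trace_ge hmono (Submodule.span ℝ {x - P x}) ?_
    · rwa [finrank_span_singleton hy] at this
    intro v hv
    obtain ⟨c, rfl⟩ := Submodule.mem_span_singleton.1 hv
    rw [map_smul]
    congr 1
    apply hfix
    filter_upwards [lt_mem_nhds (show (-1:ℝ) < 0 by norm_num)] with t ht
    refine h.unique (h.mem x) fun z hz => ?_
    have e : x + t • (x - P x) - P x = (1 + t) • (x - P x) := by rw [add_smul, one_smul]; abel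
    rw [e, inner_smul_left]
    exact mul_nonpos_of_nonneg_of_nonpos (by simp; linarith) (h.inner_le x z hz)
  · have := trace_ge hmono ((affineSpan ℝ K).directionᗮ) ?_
    · have e := (affineSpan ℝ K).direction.finrank_add_finrank_orthogonal
      have : n = Module.finrank ℝ ((affineSpan ℝ K).directionᗮ) := by omega
      rwa [this]
    intro v hv
    apply hfix
    refine Filter.Eventually.of_forall fun t => ?_
    refine h.unique (h.mem x) fun z hz => ?_
    have e : x + t • v - P x = (x - P x) + t • v := by abel
    have h0 : ⟪v, z - P x⟫ = 0 := by
      rw [real_inner_comm]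
      refine (Submodule.mem_orthogonal _ _).1 hv _ ?_
      exact AffineSubspace.vsub_mem_direction (subset_affineSpan ℝ K hz)
        (subset_affineSpan ℝ K (h.mem x))
    rw [e, inner_add_left, inner_smul_left, h0]
    simpa using h.inner_le x z hz

theorem ibp [MeasurableSpace E] [BorelSpace E] {X : E → E} {C : NNReal}
    (hX : LipschitzWith C X) {u : E → ℝ}
    (hu : ContDiff ℝ 1 u) (huc : HasCompactSupport u) :
    Integrable (fun x => u x * LinearMap.trace ℝ E (fderiv ℝ X x : E →ₗ[ℝ] E) + fderiv ℝ u x (X x))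
      ∧ ∫ x, (u x * LinearMap.trace ℝ E (fderiv ℝ X x : E →ₗ[ℝ] E) + fderiv ℝ u x (X x)) = 0 := by
  let b := stdOrthonormalBasis ℝ E
  obtain ⟨D, hD⟩ := hu.lipschitzWith_of_hasCompactSupport huc one_ne_zero
  have hXi : ∀ i, LipschitzWith (‖innerSL ℝ (b i)‖₊ * C) (fun x => ⟪b i, X x⟫) := by
    intro i
    exact (innerSL ℝ (b i)).lipschitz.comp hX
  have hud : ∀ x v, lineDeriv ℝ u x v = fderiv ℝ u x v := fun x v =>
    (hu.differentiable one_ne_zero x).lineDeriv_eq_fderiv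
  have hi1 : ∀ i, Integrable (fun x => lineDeriv ℝ (fun x => ⟪b i, X x⟫) x (b i) * u x) := by
    intro i
    exact ((hu.continuous.integrable_of_hasCompactSupport huc).bdd_mul
      (aestronglyMeasurable_lineDeriv (hXi i).continuous _)
      (Filter.Eventually.of_forall fun x => norm_lineDeriv_le_of_lipschitz ℝ (hXi i)))
  have hi2 : ∀ i, Integrable (fun x => fderiv ℝ u x (b i) * ⟪b i, X x⟫) := by
    intro i
    apply Continuous.integrable_of_hasCompactSupport
    · have h1 := hu.continuous_fderiv one_ne_zero
      have := (hXi i).continuous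
      exact (h1.clm_apply continuous_const).mul this
    · exact HasCompactSupport.mul_right (huc.fderiv_apply ℝ (b i))
  have hi : ∀ i, Integrable (fun x => lineDeriv ℝ (fun x => ⟪b i, X x⟫) x (b i) * u x
        + fderiv ℝ u x (b i) * ⟪b i, X x⟫) := fun i => (hi1 i).add (hi2 i)
  have hae : (fun x => u x * LinearMap.trace ℝ E (fderiv ℝ X x : E →ₗ[ℝ] E) + fderiv ℝ u x (X x))
     =ᵐ[volume] fun x => ∑ i, (lineDeriv ℝ (fun x => ⟪b i, X x⟫) x (b i) * u x
        + fderiv ℝ u x (b i) * ⟪b i, X x⟫) := by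
    filter_upwards [hX.ae_differentiableAt] with x hx
    rw [Finset.sum_add_distrib, LinearMap.trace_eq_sum_inner _ b, ← Finset.sum_mul, mul_comm]
    congr 1
    · congr 1
      refine Finset.sum_congr rfl fun i _ => ?_
      have : HasFDerivAt (fun x => ⟪b i, X x⟫) ((innerSL ℝ (b i)).comp (fderiv ℝ X x)) x :=
        (innerSL ℝ (b i)).hasFDerivAt.comp x hx.hasFDerivAt
      rw [(this.hasLineDerivAt (b i)).lineDeriv]
      simp
    · conv_lhs => rw [← b.sum_repr' (X x)]
      rw [map_sum]
      refine Finset.sum_congr rfl fun i _ => ?_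
      rw [map_smul, smul_eq_mul, mul_comm]
  constructor
  · rw [integrable_congr hae]
    exact integrable_finsetSum _ fun i _ => hi i
  · rw [integral_congr_ae hae, integral_finsetSum _ fun i _ => hi i]
    refine Finset.sum_eq_zero fun i _ => ?_
    rw [integral_add (hi1 i) (hi2 i), (hXi i).integral_lineDeriv_mul_eq hD huc (b i)]
    simp only [hud, map_neg, neg_mul, integral_neg]
    ring

end Geometry

theorem inner_grad {d : ℕ} (f : EuclideanSpace ℝ (Fin d) → ℝ) (x v : EuclideanSpace ℝ (Fin d)) :
    ⟪gradient f x, v⟫ = fderiv ℝ f x v := by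
  simp [gradient, InnerProductSpace.toDual_symm_apply]

/-- gradient in coordinates -/
def gr {d : ℕ} (φ : EuclideanSpace ℝ (Fin d) → ℝ) (x : EuclideanSpace ℝ (Fin d)) :
    EuclideanSpace ℝ (Fin d) :=
  ∑ i, fderiv ℝ φ x (EuclideanSpace.basisFun (Fin d) ℝ i) • EuclideanSpace.basisFun (Fin d) ℝ i

theorem gradient_eq_gr {d : ℕ} (φ : EuclideanSpace ℝ (Fin d) → ℝ) (x : EuclideanSpace ℝ (Fin d)) :
    gradient φ x = gr φ x := by
  rw [gr, ← (EuclideanSpace.basisFun (Fin d) ℝ).sum_repr' (gradient φ x)]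
  refine Finset.sum_congr rfl fun i _ => ?_
  rw [real_inner_comm, inner_grad]

theorem contDiff_gr {d : ℕ} {φ : EuclideanSpace ℝ (Fin d) → ℝ} (hφ : ContDiff ℝ 2 φ) :
    ContDiff ℝ 1 (gr φ) := by
  have h : ContDiff ℝ 1 (fderiv ℝ φ) := hφ.fderiv_right (by norm_num)
  unfold gr
  refine ContDiff.sum fun i _ => ?_
  exact (h.clm_apply contDiff_const).smul contDiff_const

theorem trace_gr {d : ℕ} {φ : EuclideanSpace ℝ (Fin d) → ℝ} (hφ : ContDiff ℝ 2 φ)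
    (x : EuclideanSpace ℝ (Fin d)) :
    LinearMap.trace ℝ _ (fderiv ℝ (gr φ) x : EuclideanSpace ℝ (Fin d) →ₗ[ℝ] EuclideanSpace ℝ (Fin d))
      = lapl φ x := by
  let b := EuclideanSpace.basisFun (Fin d) ℝ
  have h : ContDiff ℝ 1 (fderiv ℝ φ) := hφ.fderiv_right (by norm_num)
  have hd := h.differentiable one_ne_zero x
  rw [LinearMap.trace_eq_sum_inner _ b, lapl]
  refine Finset.sum_congr rfl fun i _ => ?_
  rw [iteratedFDeriv_two_apply]
  have e : (fun y => ⟪b i, gr φ y⟫) = fun y => fderiv ℝ φ y (b i) := by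
    ext1 y
    rw [← gradient_eq_gr, real_inner_comm, inner_grad]
  have h1 : HasFDerivAt (fun y => ⟪b i, gr φ y⟫) ((innerSL ℝ (b i)).comp (fderiv ℝ (gr φ) x)) x :=
    (innerSL ℝ (b i)).hasFDerivAt.comp x
      ((contDiff_gr hφ).differentiable one_ne_zero x).hasFDerivAt
  have h2 : HasFDerivAt (fun y => fderiv ℝ φ y (b i)) ((fderiv ℝ (fderiv ℝ φ) x).flip (b i)) x := by
    simpa using hd.hasFDerivAt.clm_apply (hasFDerivAt_const (b i) x)
  rw [e] at h1
  have h3 := congrArg (fun L => L (b i)) (h1.unique h2)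
  simpa [b] using h3

theorem IsMP.hasFDerivAt_infDist {E : Type*} [NormedAddCommGroup E] [InnerProductSpace ℝ E]
    [FiniteDimensional ℝ E] {K : Set E} {P : E → E} (h : IsMP K P) {x : E}
    (hx : 0 < Metric.infDist x K) :
    HasFDerivAt (fun y => Metric.infDist y K) ((Metric.infDist x K)⁻¹ • innerSL ℝ (x - P x)) x := by
  have := (h.hasFDerivAt_sq x).sqrt (by positivity)
  simp only [Real.sqrt_sq Metric.infDist_nonneg] at this
  convert! this using 1
  rw [smul_smul]; congr 1; field_simp

theorem IsMP.contDiffAt_infDist {E : Type*} [NormedAddCommGroup E] [InnerProductSpace ℝ E]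
    [FiniteDimensional ℝ E] {K : Set E} {P : E → E} (h : IsMP K P) {x : E}
    (hx : 0 < Metric.infDist x K) :
    ContDiffAt ℝ 1 (fun y => Metric.infDist y K) x := by
  have := (h.contDiff_sq.contDiffAt (x := x)).sqrt (by positivity)
  simpa only [Real.sqrt_sq Metric.infDist_nonneg] using this

theorem hasDerivAt_c (δ δ' : ℝ) {s : ℝ} (hs : 0 < s) :
    HasDerivAt (fun s : ℝ => s ^ δ * (1 + s) ^ (δ' - δ))
      (s ^ δ * (1 + s) ^ (δ' - δ) * ((δ + δ' * s) / (1 + s)) / s) s := by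
  have h1 : HasDerivAt (fun s : ℝ => s ^ δ) (δ * s ^ (δ - 1)) s :=
    Real.hasDerivAt_rpow_const (Or.inl hs.ne')
  have h2 : HasDerivAt (fun s : ℝ => (1 + s) ^ (δ' - δ)) (1 * (δ' - δ) * (1 + s) ^ (δ' - δ - 1)) s :=
    ((hasDerivAt_id s).const_add 1).rpow_const (Or.inl (by simp; positivity))
  convert! h1.mul h2 using 1
  rw [Real.rpow_sub_one hs.ne', Real.rpow_sub_one (by positivity)]
  field_simp
  ring

theorem alg {D m γ c w s L G b T f : ℝ} (hs : 0 < s) (hc : c = w * s ^ 2)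
    (hG : b ^ 2 ≤ s ^ 2 * G) (hT : D ≤ T) (hD : 0 < D) (hC : 0 < D + 2 * m - 4)
    (hm : m ≤ γ) (hγ : γ < 2) :
    2 * (D * (D + 2 * m - 4) / 4) * (-(c * w * f * L +
      (c * w * G + f * (w * (w * γ * b) + c * (w * (γ - 2) / s ^ 2 * b))))
      - (m + D - 2) / 2 * (w ^ 2 * f ^ 2 * T
        + (2 * w ^ 2 * f * b + 2 * f ^ 2 * w * (w * (γ - 2) / s ^ 2 * s ^ 2))))
    ≤ (-c * L - w * γ * b) ^ 2 - (D * (D + 2 * m - 4) / 4) ^ 2 * (w ^ 2 * f ^ 2) := by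
  have e1 : w * (γ - 2) / s ^ 2 * s ^ 2 = w * (γ - 2) := by field_simp
  have e2 : c * (w * (γ - 2) / s ^ 2 * b) = w * w * (γ - 2) * b := by rw [hc]; field_simp
  rw [e1, e2]
  have hκ : 0 < (m + D - 2) / 2 := by linarith
  have hCp : 0 < D * (D + 2 * m - 4) / 4 := by positivity
  set C := D * (D + 2 * m - 4) / 4 with hCdef
  set κ := (m + D - 2) / 2 with hκdef
  -- main coefficient bound
  have hcoef : C ≤ κ * (D + 2 * γ - 4) - ((γ + m + D - 4) / 2) ^ 2 := by
    rw [hCdef, hκdef]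
    nlinarith [mul_nonneg (sub_nonneg.2 hm) (by linarith : 0 ≤ 2 * (D + 2 * m - 4) + 8 - 4 * m - (γ - m))]
  have hmain : C * f ^ 2 ≤ s ^ 2 * G + (γ - 2) * f * b
      + κ * (T * f ^ 2 + 2 * f * b + 2 * (γ - 2) * f ^ 2) := by
    have h1 : κ * (D * f ^ 2) ≤ κ * (T * f ^ 2) := by gcongr
    have h2 := mul_le_mul_of_nonneg_right hcoef (sq_nonneg f)
    have h3 : 0 ≤ (b + (γ + m + D - 4) / 2 * f) ^ 2 := sq_nonneg _
    have h4 : (γ - 2) * f * b + κ * (2 * f * b) = (γ + m + D - 4) * f * b := by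
      rw [hκdef]; ring
    nlinarith
  have h5 := mul_le_mul_of_nonneg_left hmain (by positivity : 0 ≤ 2 * C * w ^ 2)
  have h6 : 0 ≤ ((-c * L - w * γ * b) - C * (w * f)) ^ 2 := sq_nonneg _
  subst hc
  nlinarith

theorem contDiff_mul_of_support {E : Type*} [NormedAddCommGroup E] [NormedSpace ℝ E]
    {K : Set E} {g φ : E → ℝ} (hg : ∀ x ∈ Kᶜ, ContDiffAt ℝ 1 g x) (hφ : ContDiff ℝ 1 φ)
    (hφs : tsupport φ ⊆ Kᶜ) : ContDiff ℝ 1 (fun x => g x * φ x) := by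
  rw [contDiff_iff_contDiffAt]
  intro x
  by_cases hx : x ∈ tsupport φ
  · exact (hg x (hφs hx)).mul hφ.contDiffAt
  · have h0 := notMem_tsupport_iff_eventuallyEq.1 hx
    refine (contDiffAt_const (c := (0:ℝ))).congr_of_eventuallyEq ?_
    filter_upwards [h0] with y hy
    simp [hy]

theorem Hop_eq_gr {d : ℕ} (K : Set (EuclideanSpace ℝ (Fin d))) (δ δ' : ℝ)
    (φ : EuclideanSpace ℝ (Fin d) → ℝ) (x : EuclideanSpace ℝ (Fin d)) :
    Hop K δ δ' φ x = -(cWeight K δ δ' x) * lapl φ x - fderiv ℝ (cWeight K δ δ') x (gr φ x) := by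
  rw [Hop, inner_grad, gradient_eq_gr]

theorem continuous_lapl {d : ℕ} {φ : EuclideanSpace ℝ (Fin d) → ℝ} (hφ : ContDiff ℝ 2 φ) :
    Continuous (lapl φ) := by
  unfold lapl
  refine continuous_finsetSum _ fun i _ => ?_
  have := hφ.continuous_iteratedFDeriv (m := 2) (by norm_num)
  exact (ContinuousMultilinearMap.apply ℝ _ ℝ
    (fun _ : Fin 2 => EuclideanSpace.single i (1:ℝ))).continuous.comp this

theorem lapl_zero {d : ℕ} {φ : EuclideanSpace ℝ (Fin d) → ℝ} {x : EuclideanSpace ℝ (Fin d)}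
    (hx : x ∉ tsupport φ) : lapl φ x = 0 := by
  unfold lapl
  have h : iteratedFDeriv ℝ 2 φ x = 0 := by
    have := support_iteratedFDeriv_subset (𝕜 := ℝ) (f := φ) 2
    by_contra h
    exact hx (this h)
  simp [h]

theorem gr_zero {d : ℕ} {φ : EuclideanSpace ℝ (Fin d) → ℝ} {x : EuclideanSpace ℝ (Fin d)}
    (hx : x ∉ tsupport φ) : gr φ x = 0 := by
  unfold gr
  simp [fderiv_of_notMem_tsupport ℝ hx]

theorem Hop_zero {d : ℕ} (K : Set (EuclideanSpace ℝ (Fin d))) (δ δ' : ℝ)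
    {φ : EuclideanSpace ℝ (Fin d) → ℝ} {x : EuclideanSpace ℝ (Fin d)}
    (hx : x ∉ tsupport φ) : Hop K δ δ' φ x = 0 := by
  rw [Hop_eq_gr, lapl_zero hx, gr_zero hx]; simp

theorem continuous_Hop {d : ℕ} {K : Set (EuclideanSpace ℝ (Fin d))} {δ δ' : ℝ}
    {φ : EuclideanSpace ℝ (Fin d) → ℝ} (hφ : ContDiff ℝ 2 φ) (hφs : tsupport φ ⊆ Kᶜ)
    (hc : ∀ x ∈ Kᶜ, ContDiffAt ℝ 1 (cWeight K δ δ') x) : Continuous (Hop K δ δ' φ) := by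
  rw [continuous_iff_continuousAt]
  intro x
  by_cases hx : x ∈ tsupport φ
  · have h1 := hc x (hφs hx)
    have h2 : ContinuousAt (fderiv ℝ (cWeight K δ δ')) x :=
      (h1.fderiv_right (m := 0) (by norm_num)).continuousAt
    have e : Hop K δ δ' φ = fun x => -(cWeight K δ δ' x) * lapl φ x
      - fderiv ℝ (cWeight K δ δ') x (gr φ x) := by ext1 x; exact Hop_eq_gr _ _ _ _ _
    rw [e]
    exact (h1.continuousAt.neg.mul (continuous_lapl hφ).continuousAt).sub
      (h2.clm_apply (contDiff_gr hφ).continuous.continuousAt)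
  · refine (continuousAt_const (y := (0:ℝ))).congr ?_
    have : (tsupport φ)ᶜ ∈ nhds x := (isClosed_tsupport φ).isOpen_compl.mem_nhds hx
    filter_upwards [this] with y hy
    exact (Hop_zero K δ δ' hy).symm

theorem fin_int {α : Type*} [MeasurableSpace α] {μ : Measure α} {I1 I2 F W : α → ℝ}
    (i1 : Integrable I1 μ) (z1 : ∫ x, I1 x ∂μ = 0) (i2 : Integrable I2 μ) (z2 : ∫ x, I2 x ∂μ = 0)
    (iF : Integrable F μ) (iW : Integrable W μ) {a κ C : ℝ}
    (h : ∀ᵐ x ∂μ, a * (-(I1 x) - κ * I2 x) ≤ F x - C * W x) :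
    C * ∫ x, W x ∂μ ≤ ∫ x, F x ∂μ := by
  have j1 : Integrable (fun x => -(I1 x)) μ := i1.neg
  have j2 : Integrable (fun x => κ * I2 x) μ := i2.const_mul κ
  have j3 : Integrable (fun x => C * W x) μ := iW.const_mul C
  have j4 : Integrable (fun x => -(I1 x) - κ * I2 x) μ := j1.sub j2
  have j5 : Integrable (fun x => F x - C * W x) μ := iF.sub j3
  have hint := integral_mono_ae (j4.const_mul a) j5 h
  rw [integral_const_mul, integral_sub j1 j2, integral_neg, integral_const_mul, z1, z2,
    integral_sub iF j3, integral_const_mul] at hint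
  linarith

/-- The `L_2`-Rellich inequality with the optimal constant `C_2`
(Proposition 4.10 of the paper). -/
theorem rellich_inequality_L2
    (d : ℕ) (hd : 1 ≤ d) (K : Set (EuclideanSpace ℝ (Fin d)))
    (hKne : K.Nonempty) (hKcl : IsClosed K) (hKconv : Convex ℝ K)
    (hKproper : K ≠ Set.univ)
    (dH : ℕ) (hdH : dH = min (Module.finrank ℝ (affineSpan ℝ K).direction) (d - 1))
    (δ δ' : ℝ) (hδ0 : 0 ≤ δ) (hδ2 : δ < 2) (hδ'0 : 0 ≤ δ') (hδ'2 : δ' < 2)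
    (hcond : 0 < (d : ℝ) - dH + 2 * min δ δ' - 4)
    (φ : EuclideanSpace ℝ (Fin d) → ℝ) (hφ : ContDiff ℝ 2 φ)
    (hφc : HasCompactSupport φ) (hφs : tsupport φ ⊆ Kᶜ) :
    (∫ x in Kᶜ, |Hop K δ δ' φ x| ^ (2 : ℕ))
      ≥ (((d : ℝ) - dH) * ((d : ℝ) - dH + 2 * min δ δ' - 4) / 4) ^ (2 : ℕ) *
          ∫ x in Kᶜ,
            (cWeight K δ δ' x * Metric.infDist x K ^ (-(2 : ℝ))) ^ (2 : ℕ) *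
              |φ x| ^ (2 : ℕ) := by
  obtain ⟨P, hP⟩ := exists_isMP hKne hKcl hKconv
  have hpos : ∀ x ∈ Kᶜ, 0 < Metric.infDist x K := fun x hx =>
    (hKcl.notMem_iff_infDist_pos hKne).1 hx
  have hn : ((d - dH : ℕ) = 1 ∨
      (d - dH : ℕ) + Module.finrank ℝ (affineSpan ℝ K).direction
        = Module.finrank ℝ (EuclideanSpace ℝ (Fin d))) := by
    rw [finrank_euclideanSpace_fin]
    omega
  have hdle : dH < d := by omega
  have hDcast : ((d - dH : ℕ) : ℝ) = (d : ℝ) - dH := by push_cast [hdle.le]; ring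
  have hDpos : 0 < (d : ℝ) - dH := by
    rw [sub_pos]; exact_mod_cast hdle
  set m := min δ δ' with hm
  set w : EuclideanSpace ℝ (Fin d) → ℝ :=
    fun x => cWeight K δ δ' x * Metric.infDist x K ^ (-(2 : ℝ)) with hw
  set c := cWeight K δ δ' with hcdef
  set D : ℝ := (d : ℝ) - dH with hD
  -- smoothness
  have hcC : ∀ x ∈ Kᶜ, ContDiffAt ℝ 1 c x := by
    intro x hx
    have h0 := hpos x hx
    have h1 := hP.contDiffAt_infDist h0
    exact (h1.rpow_const_of_ne h0.ne').mul
      ((contDiffAt_const.add h1).rpow_const_of_ne (by positivity))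
  have hwC : ∀ x ∈ Kᶜ, ContDiffAt ℝ 1 w x := by
    intro x hx
    have h0 := hpos x hx
    have h1 := hP.contDiffAt_infDist h0
    exact (hcC x hx).mul (h1.rpow_const_of_ne h0.ne')
  have hφ1 : ContDiff ℝ 1 φ := hφ.of_le (by norm_num)
  have hu1 : ContDiff ℝ 1 (fun x => (c x * w x) * φ x) :=
    contDiff_mul_of_support (fun x hx => (hcC x hx).mul (hwC x hx)) hφ1 hφs
  have hu2 : ContDiff ℝ 1 (fun x => ((w x * w x) * φ x) * φ x) :=
    (contDiff_mul_of_support (fun x hx => (hwC x hx).mul (hwC x hx)) hφ1 hφs).mul hφ1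
  have hu1c : HasCompactSupport (fun x => (c x * w x) * φ x) := HasCompactSupport.mul_left hφc
  have hu2c : HasCompactSupport (fun x => ((w x * w x) * φ x) * φ x) :=
    HasCompactSupport.mul_left hφc
  have hgrc : HasCompactSupport (gr φ) := HasCompactSupport.intro hφc fun x hx => gr_zero hx
  obtain ⟨C1, hC1⟩ := (contDiff_gr hφ).lipschitzWith_of_hasCompactSupport hgrc one_ne_zero
  obtain ⟨i1, z1⟩ := ibp hC1 hu1 hu1c
  obtain ⟨i2, z2⟩ := ibp hP.lip hu2 hu2c
  -- the pointwise inequality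
  have hae : ∀ᵐ x : EuclideanSpace ℝ (Fin d),
      2 * (D * (D + 2 * m - 4) / 4) *
       (-((c x * w x) * φ x * LinearMap.trace ℝ _ (fderiv ℝ (gr φ) x : EuclideanSpace ℝ (Fin d) →ₗ[ℝ] _)
          + fderiv ℝ (fun x => (c x * w x) * φ x) x (gr φ x))
        - (m + D - 2) / 2 *
        (((w x * w x) * φ x) * φ x * LinearMap.trace ℝ _
            (fderiv ℝ (fun x => x - P x) x : EuclideanSpace ℝ (Fin d) →ₗ[ℝ] _)
          + fderiv ℝ (fun x => ((w x * w x) * φ x) * φ x) x (x - P x)))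
      ≤ Hop K δ δ' φ x ^ 2 - (D * (D + 2 * m - 4) / 4) ^ 2 * (w x ^ 2 * φ x ^ 2) := by
    filter_upwards [hP.lip.ae_differentiableAt] with x hx
    by_cases hxs : x ∈ tsupport φ
    swap
    · have f0 : φ x = 0 := image_eq_zero_of_notMem_tsupport hxs
      have n1 : x ∉ tsupport (fun x => ((w x * w x) * φ x) * φ x) :=
        fun h => hxs (tsupport_mul_subset_right h)
      rw [gr_zero hxs, Hop_zero _ _ _ hxs, f0, fderiv_of_notMem_tsupport ℝ n1]
      simp
    have hxK := hφs hxs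
    have s0 := hpos x hxK
    have hT := hP.trace_fderiv_ge s0.ne' hx.hasFDerivAt hn
    rw [hDcast] at hT
    set s := Metric.infDist x K with hs
    set γ := (δ + δ' * s) / (1 + s) with hγ
    have hmγ : m ≤ γ := by
      rw [hγ, le_div_iff₀ (by positivity)]
      nlinarith [min_le_left δ δ', min_le_right δ δ']
    have hγ2 : γ < 2 := by
      rw [hγ, div_lt_iff₀ (by positivity)]
      nlinarith
    have hinv : s ^ (-(2:ℝ)) = (s ^ 2)⁻¹ := by
      rw [Real.rpow_neg s0.le]; norm_cast
    have hwx : w x = c x * (s ^ 2)⁻¹ := by rw [← hinv]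
    have hcw : c x = w x * s ^ 2 := by rw [hwx]; field_simp
    have hdist := hP.hasFDerivAt_infDist s0
    have hdc : HasFDerivAt c ((w x * γ) • innerSL ℝ (x - P x)) x := by
      have := (hasDerivAt_c δ δ' s0).comp_hasFDerivAt x hdist
      convert! this using 1
      rw [smul_smul]; congr 1
      have hcx : c x = s ^ δ * (1 + s) ^ (δ' - δ) := rfl
      rw [← hs, ← hγ, hwx, ← hcx]
      field_simp
    have hdr : HasFDerivAt (fun y => Metric.infDist y K ^ (-(2:ℝ)))
        ((-(2 / s ^ 4)) • innerSL ℝ (x - P x)) x := by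
      have := (Real.hasDerivAt_rpow_const (p := -(2:ℝ)) (Or.inl s0.ne')).comp_hasFDerivAt x hdist
      convert! this using 1
      rw [smul_smul]; congr 1
      rw [Real.rpow_sub_one s0.ne', ← hs, hinv]
      field_simp
    have hdw : HasFDerivAt w ((w x * (γ - 2) / s ^ 2) • innerSL ℝ (x - P x)) x := by
      convert! hdc.mul hdr using 1
      rw [smul_smul, smul_smul, ← add_smul]; congr 1
      rw [← hs, hinv, hcw]
      field_simp
      ring
    have hdφ := (hφ1.differentiable one_ne_zero x).hasFDerivAt
    have hdu1 := (hdc.mul hdw).mul hdφ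
    have hdu2 := ((hdw.mul hdw).mul hdφ).mul hdφ
    have hYY : ⟪x - P x, x - P x⟫ = s ^ 2 := by
      rw [real_inner_self_eq_norm_sq, hs, hP.dist_eq]
    have hφv : ∀ v, fderiv ℝ φ x v = ⟪gr φ x, v⟫ := fun v => by rw [← gradient_eq_gr, inner_grad]
    have hG : ⟪x - P x, gr φ x⟫ ^ 2 ≤ s ^ 2 * ⟪gr φ x, gr φ x⟫ := by
      have := real_inner_mul_inner_self_le (x - P x) (gr φ x)
      rw [hYY] at this
      linarith [sq ⟪x - P x, gr φ x⟫]
    have hHop : Hop K δ δ' φ x = -c x * lapl φ x - w x * γ * ⟪x - P x, gr φ x⟫ := by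
      rw [Hop_eq_gr, ← hcdef, hdc.fderiv, smul_apply, innerSL_apply_apply, smul_eq_mul]
    have key := alg (L := lapl φ x) (f := φ x) s0 hcw hG hT hDpos
      (by linarith : 0 < D + 2 * m - 4) hmγ hγ2
    have e1 : fderiv ℝ (fun x => (c x * w x) * φ x) x (gr φ x) =
        (c x * w x * ⟪gr φ x, gr φ x⟫ + φ x * (w x * (w x * γ * ⟪x - P x, gr φ x⟫)
          + c x * (w x * (γ - 2) / s ^ 2 * ⟪x - P x, gr φ x⟫))) := by
      have h := congrArg (fun L => L (gr φ x)) hdu1.fderiv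
      refine Eq.trans h ?_
      simp only [add_apply, smul_apply, innerSL_apply_apply, smul_eq_mul, hφv, Pi.mul_apply]
      ring
    have e2 : fderiv ℝ (fun x => ((w x * w x) * φ x) * φ x) x (x - P x) =
        (2 * w x ^ 2 * φ x * ⟪x - P x, gr φ x⟫
          + 2 * φ x ^ 2 * w x * (w x * (γ - 2) / s ^ 2 * s ^ 2)) := by
      have h := congrArg (fun L => L (x - P x)) hdu2.fderiv
      refine Eq.trans h ?_
      simp only [add_apply, smul_apply, innerSL_apply_apply, smul_eq_mul, hφv, Pi.mul_apply, hYY]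
      rw [real_inner_comm (x - P x) (gr φ x)]
      ring
    rw [e1, e2, hHop, trace_gr hφ]
    convert key using 2
    ring
  -- integrate
  have hcH := continuous_Hop hφ hφs hcC
  have hHs : HasCompactSupport (fun x => Hop K δ δ' φ x ^ 2) :=
    HasCompactSupport.intro hφc fun x hx => by simp [Hop_zero _ _ _ hx]
  have iH : Integrable (fun x => Hop K δ δ' φ x ^ 2) :=
    (hcH.pow 2).integrable_of_hasCompactSupport hHs
  have iW : Integrable (fun x => w x ^ 2 * φ x ^ 2) := by
    have := hu2.continuous.integrable_of_hasCompactSupport (μ := volume) hu2c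
    refine this.congr (Filter.Eventually.of_forall fun x => ?_)
    simp only; ring
  have hint := fin_int i1 z1 i2 z2 iH iW hae
  rw [setIntegral_eq_integral_of_forall_compl_eq_zero, setIntegral_eq_integral_of_forall_compl_eq_zero]
  · simp only [sq_abs]
    exact hint
  · intro x hx
    rw [image_eq_zero_of_notMem_tsupport fun h => hx (hφs h)]; simp
  · intro x hx
    rw [Hop_zero _ _ _ fun h => hx (hφs h)]; simp
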